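/- Let d > 1 and v ≥ 24d be integers. Every simple graph G on v vertices with at least (2d-1)·v - 2d² + d edges contains d pairwise vertex-disjoint cycles, or contains 2d-1 vertices each of degree v-1. -/

import Mathlib

namespace SimpleGraph

section DegreeSum

variable {V : Type*} {G : SimpleGraph V} [DecidableRel G.Adj]

variable (G) in
/-- The number of neighbors of `v` in `S`. -/
def degIn (S : Finset V) (v : V) : ℕ := (S.filter (G.Adj v)).card

variable (G) in
/-- The sum of the degrees in the subgraph induced on `S`, twice its number of edges. -/
def degSum (S : Finset V) : ℕ := ∑ v ∈ S, G.degIn S v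

theorem degIn_lt_card {S : Finset V} {v : V} (hv : v ∈ S) : G.degIn S v + 1 ≤ S.card := by
  refine Finset.card_lt_card (Finset.filter_ssubset.2 ⟨v, hv, G.loopless.irrefl v⟩)

theorem sum_degIn_comm (A B : Finset V) :
    ∑ v ∈ A, G.degIn B v = ∑ v ∈ B, G.degIn A v := by
  simp only [degIn, Finset.card_filter]
  rw [Finset.sum_comm]
  simp only [G.adj_comm]

theorem exists_ne_of_two_le_degIn {S : Finset V} {v : V} (h : 2 ≤ G.degIn S v) :
    ∃ a ∈ S, ∃ b ∈ S, a ≠ b ∧ G.Adj v a ∧ G.Adj v b := by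
  obtain ⟨a, ha, b, hb, hab⟩ := Finset.one_lt_card.1 (show 1 < (S.filter (G.Adj v)).card from h)
  rw [Finset.mem_filter] at ha hb
  exact ⟨a, ha.1, b, hb.1, hab, ha.2, hb.2⟩

end DegreeSum

variable {V : Type*} [DecidableEq V] (G : SimpleGraph V)

/-- `C` is the vertex set of a cycle of `G`. -/
def IsCycleSet (C : Finset V) : Prop :=
  ∃ (u : V) (w : G.Walk u u), w.IsCycle ∧ w.support.toFinset = C

/-- Some cycle of `G` has all its vertices in `S`. -/
def ContainsCycle (S : Finset V) : Prop :=
  ∃ C ⊆ S, G.IsCycleSet C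

/-- `S` contains the vertex sets of `k` pairwise disjoint cycles of `G`. -/
def CyclePacking : ℕ → Finset V → Prop
  | 0, _ => True
  | k + 1, S => ∃ C ⊆ S, G.IsCycleSet C ∧ CyclePacking k (S \ C)

variable {G}

theorem ContainsCycle.mono {S T : Finset V} (h : G.ContainsCycle S) (hST : S ⊆ T) :
    G.ContainsCycle T := by
  obtain ⟨C, hC, hc⟩ := h
  exact ⟨C, hC.trans hST, hc⟩

theorem CyclePacking.mono {k : ℕ} {S T : Finset V} (h : G.CyclePacking k S) (hST : S ⊆ T) :
    G.CyclePacking k T := by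
  induction k generalizing S T with
  | zero => trivial
  | succ k ih =>
    obtain ⟨C, hC, hc, hp⟩ := h
    exact ⟨C, hC.trans hST, hc, ih hp (Finset.sdiff_subset_sdiff hST subset_rfl)⟩

theorem CyclePacking.succ_of_containsCycle {k : ℕ} {S T : Finset V} (hT : G.CyclePacking k T)
    (hS : G.ContainsCycle S) (hST : Disjoint S T) : G.CyclePacking (k + 1) (S ∪ T) := by
  obtain ⟨C, hC, hc⟩ := hS
  refine ⟨C, hC.trans Finset.subset_union_left, hc, hT.mono fun v hv => ?_⟩
  have := Finset.disjoint_right.1 hST hv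
  simp only [Finset.mem_sdiff, Finset.mem_union]
  exact ⟨Or.inr hv, fun h => this (hC h)⟩

theorem containsCycle_iff_cyclePacking_one {S : Finset V} :
    G.ContainsCycle S ↔ G.CyclePacking 1 S := by
  simp [ContainsCycle, CyclePacking]

/-- The disjoint cycles packed in `S` as an indexed family of walks. -/
theorem CyclePacking.exists_walks {k : ℕ} {S : Finset V} (h : G.CyclePacking k S) :
    ∃ (c : Fin k → V) (w : ∀ i : Fin k, G.Walk (c i) (c i)), (∀ i, (w i).IsCycle) ∧
      (∀ i, ∀ x ∈ (w i).support, x ∈ S) ∧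
      ∀ i j, i ≠ j → ∀ x, x ∈ (w i).support → x ∉ (w j).support := by
  induction k generalizing S with
  | zero => exact ⟨Fin.elim0, fun i => i.elim0, fun i => i.elim0, fun i => i.elim0,
      fun i => i.elim0⟩
  | succ k ih =>
    obtain ⟨C, hCS, ⟨u, w₀, hw₀, rfl⟩, hp⟩ := h
    obtain ⟨c, w, hw, hs, hd⟩ := ih hp
    refine ⟨Fin.cons u c, Fin.cons w₀ w, ?_, ?_, ?_⟩
    · exact Fin.cases hw₀ hw
    · refine Fin.cases (fun x hx => hCS (List.mem_toFinset.2 hx)) fun i x hx => ?_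
      exact (Finset.mem_sdiff.1 (hs i x hx)).1
    · refine Fin.cases (Fin.cases (by simp) fun j _ x hx hxj => ?_)
        fun i => Fin.cases (fun _ x hxi hx => ?_) fun j hij => ?_
      · exact (Finset.mem_sdiff.1 (hs j x hxj)).2 (List.mem_toFinset.2 hx)
      · exact (Finset.mem_sdiff.1 (hs i x hxi)).2 (List.mem_toFinset.2 hx)
      · exact hd i j (by simpa using hij)

theorem exists_isCycleSet_of_walk {x a b : V} (q : G.Walk a b) (hx : x ∉ q.support)
    (hxa : G.Adj x a) (hxb : G.Adj x b) (hab : a ≠ b) :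
    ∃ C, G.IsCycleSet C ∧ C ⊆ insert x q.support.toFinset ∧ C.card ≤ q.length + 2 := by
  have hxp : x ∉ q.bypass.support := fun h => hx (q.support_bypass_subset_support h)
  refine ⟨_, ⟨x, Walk.cons hxa (q.bypass.concat hxb.symm), ?_, rfl⟩, ?_, ?_⟩
  · rw [Walk.cons_isCycle_iff]
    refine ⟨q.bypass_isPath.concat hxp _, ?_⟩
    rw [Walk.edges_concat]
    simp only [List.concat_eq_append, List.mem_append, List.mem_singleton, not_or]
    refine ⟨fun h => hxp (Walk.fst_mem_support_of_mem_edges _ h), ?_⟩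
    simp only [Sym2.eq_iff, not_or, not_and]
    exact ⟨fun _ => hxa.ne', fun _ => hab⟩
  · intro v
    simp only [Walk.support_cons, Walk.support_concat, List.toFinset_cons, Finset.mem_insert,
      List.mem_toFinset, List.mem_append, List.mem_singleton]
    rintro (h | h | h)
    · exact Or.inl h
    · exact Or.inr (q.support_bypass_subset_support h)
    · exact Or.inl h
  · have h1 := q.length_bypass_le_length
    rw [Walk.support_cons, Walk.support_concat, List.toFinset_cons, Finset.insert_eq_of_mem (by simp)]
    refine (List.toFinset_card_le _).trans ?_
    simp; omega

theorem containsCycle_of_walk {x a b : V} (q : G.Walk a b) (hx : x ∉ q.support)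
    (hxa : G.Adj x a) (hxb : G.Adj x b) (hab : a ≠ b) :
    G.ContainsCycle (insert x q.support.toFinset) := by
  obtain ⟨C, hC, hs, -⟩ := exists_isCycleSet_of_walk q hx hxa hxb hab
  exact ⟨C, hs, hC⟩

theorem containsCycle_triangle {a b c : V} (hab : G.Adj a b) (hac : G.Adj a c)
    (hbc : G.Adj b c) : G.ContainsCycle {a, b, c} := by
  simpa using containsCycle_of_walk (x := a) (Walk.cons hbc Walk.nil)
    (by simp [hab.ne, hac.ne]) hab hac hbc.ne

theorem containsCycle_square {x y a b : V} (hxy : x ≠ y) (hab : a ≠ b) (hxa : G.Adj x a)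
    (hxb : G.Adj x b) (hya : G.Adj y a) (hyb : G.Adj y b) : G.ContainsCycle {x, y, a, b} := by
  refine (containsCycle_of_walk (x := x) (Walk.cons hya.symm (Walk.cons hyb Walk.nil))
    (by simp [hxa.ne, hxb.ne, hxy]) hxa hxb hab).mono ?_
  intro v; simp; tauto

theorem Walk.IsCycle.length_le_card_support {u : V} {w : G.Walk u u} (hw : w.IsCycle) :
    w.length ≤ w.support.toFinset.card := by
  have hsub : w.support.tail.toFinset ⊆ w.support.toFinset := fun z hz =>
    List.mem_toFinset.2 (List.mem_of_mem_tail (List.mem_toFinset.1 hz))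
  have := Finset.card_le_card hsub
  rw [List.toFinset_card_of_nodup hw.support_nodup, List.length_tail, Walk.length_support] at this
  omega

theorem IsCycleSet.three_le_card {C : Finset V} (h : G.IsCycleSet C) : 3 ≤ C.card := by
  obtain ⟨u, w, hw, rfl⟩ := h
  exact hw.three_le_length.trans hw.length_le_card_support

theorem IsCycleSet.exists_path {C : Finset V} (h : G.IsCycleSet C) :
    ∃ (u v : V) (p : G.Walk u v), p.IsPath ∧ p.support.toFinset = C := by
  obtain ⟨u, w, hw, rfl⟩ := h
  cases w with
  | nil => simp at hw
  | cons h p =>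
    refine ⟨_, _, p, ((Walk.cons_isCycle_iff p h).1 hw).1, ?_⟩
    simp

theorem containsCycle_of_getVert {x u v : V} {p : G.Walk u v} (hp : p.IsPath)
    (hx : x ∉ p.support) {i j : ℕ} (hij : i < j) (hj : j ≤ p.length)
    (hxi : G.Adj x (p.getVert i)) (hxj : G.Adj x (p.getVert j)) :
    G.ContainsCycle (insert x ((Finset.Icc i j).image p.getVert)) := by
  have hend : (p.drop i).getVert (j - i) = p.getVert j := by
    rw [Walk.drop_getVert]; congr 1; omega
  have hsub : ∀ z ∈ ((p.drop i).take (j - i)).support,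
      z ∈ (Finset.Icc i j).image p.getVert := by
    intro z hz
    obtain ⟨t, ht, -⟩ := Walk.mem_support_iff_exists_getVert.1 hz
    rw [Walk.take_getVert, Walk.drop_getVert] at ht
    exact Finset.mem_image.2 ⟨_, Finset.mem_Icc.2 (by omega), ht⟩
  refine (containsCycle_of_walk ((p.drop i).take (j - i)) (x := x) (fun h => ?_) hxi
    (hend ▸ hxj) (fun h => ?_)).mono ?_
  · obtain ⟨t, -, ht⟩ := Finset.mem_image.1 (hsub x h)
    exact hx (ht ▸ p.getVert_mem_support t)
  · have := hp.getVert_injOn (show i ≤ p.length by omega) hj (h.trans hend)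
    omega
  · exact Finset.insert_subset_insert _ fun z hz => hsub z (List.mem_toFinset.1 hz)

/-- A path with four vertices adjacent to both `x` and `y` gives two disjoint cycles when `x`
and `y` are added. -/
theorem cyclePacking_two_of_path {x y u v : V} (hxy : x ≠ y) {p : G.Walk u v} (hp : p.IsPath)
    (hx : x ∉ p.support) (hy : y ∉ p.support) {M : Finset V} (hM : M ⊆ p.support.toFinset)
    (hMx : ∀ a ∈ M, G.Adj x a) (hMy : ∀ a ∈ M, G.Adj y a) (hcard : 4 ≤ M.card) :
    G.CyclePacking 2 (insert x (insert y p.support.toFinset)) := by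
  obtain ⟨I, hI⟩ : ∃ I : Finset ℕ,
    I = (Finset.range (p.length + 1)).filter fun i => p.getVert i ∈ M := ⟨_, rfl⟩
  have hIM : M ⊆ I.image p.getVert := by
    intro a ha
    obtain ⟨i, hi, hil⟩ := Walk.mem_support_iff_exists_getVert.1 (List.mem_toFinset.1 (hM ha))
    exact Finset.mem_image.2 ⟨i, by simp [hI, hi, ha]; omega, hi⟩
  have hI4 : 4 ≤ I.card := hcard.trans ((Finset.card_le_card hIM).trans Finset.card_image_le)
  let f := I.orderEmbOfCardLe hI4
  have hmem : ∀ i ∈ I, i ≤ p.length ∧ p.getVert i ∈ M := by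
    intro i hi
    rwa [hI, Finset.mem_filter, Finset.mem_range, Nat.lt_succ_iff] at hi
  have hf : ∀ i, f i ≤ p.length ∧ p.getVert (f i) ∈ M := fun i =>
    hmem _ (I.orderEmbOfCardLe_mem hI4 i)
  have h01 : f 0 < f 1 := f.strictMono (by decide)
  have h12 : f 1 < f 2 := f.strictMono (by decide)
  have h23 : f 2 < f 3 := f.strictMono (by decide)
  have hX := containsCycle_of_getVert hp hx h01 (hf 1).1 (hMx _ (hf 0).2) (hMx _ (hf 1).2)
  have hY := containsCycle_of_getVert hp hy h23 (hf 3).1 (hMy _ (hf 2).2) (hMy _ (hf 3).2)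
  have himg : ∀ i j, (Finset.Icc i j).image p.getVert ⊆ p.support.toFinset := by
    intro i j z hz
    obtain ⟨t, -, ht⟩ := Finset.mem_image.1 hz
    exact List.mem_toFinset.2 (ht ▸ p.getVert_mem_support t)
  refine ((containsCycle_iff_cyclePacking_one.1 hY).succ_of_containsCycle hX ?_).mono ?_
  · rw [← List.mem_toFinset] at hx hy
    rw [Finset.disjoint_insert_left, Finset.disjoint_insert_right, Finset.mem_insert, not_or]
    refine ⟨⟨hxy, fun h => hx (himg _ _ h)⟩, fun h => hy (himg _ _ h), ?_⟩
    rw [Finset.disjoint_left]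
    intro z hz hz'
    obtain ⟨s, hs, rfl⟩ := Finset.mem_image.1 hz
    obtain ⟨t, ht, hts⟩ := Finset.mem_image.1 hz'
    rw [Finset.mem_Icc] at hs ht
    have h1 := (hf 1).1
    have h3 := (hf 3).1
    have := hp.getVert_injOn (show t ≤ p.length by omega) (show s ≤ p.length by omega) hts
    omega
  · refine Finset.union_subset (Finset.insert_subset_insert _ ((himg _ _).trans
      (Finset.subset_insert _ _))) ?_
    exact (Finset.insert_subset_insert _ (himg _ _)).trans (Finset.subset_insert _ _)

/-- If `x` and `y` have `3k + 2` common neighbors in a set packing `k` disjoint cycles, then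
adding `x` and `y` allows one more cycle. -/
theorem CyclePacking.succ_of_common_neighbors {x y : V} (hxy : x ≠ y) {k : ℕ} {S M : Finset V}
    (hp : G.CyclePacking k S) (hxS : x ∉ S) (hyS : y ∉ S) (hMS : M ⊆ S)
    (hMx : ∀ a ∈ M, G.Adj x a) (hMy : ∀ a ∈ M, G.Adj y a) (hcard : 3 * k + 2 ≤ M.card) :
    G.CyclePacking (k + 1) (insert x (insert y S)) := by
  induction k generalizing S M with
  | zero =>
    obtain ⟨a, ha, b, hb, hab⟩ := Finset.one_lt_card.1 (show 1 < M.card by omega)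
    refine containsCycle_iff_cyclePacking_one.1 ((containsCycle_square hxy hab (hMx a ha)
      (hMx b hb) (hMy a ha) (hMy b hb)).mono ?_)
    have := hMS ha
    have := hMS hb
    intro z; simp; rintro (rfl | rfl | rfl | rfl) <;> simp [*]
  | succ k ih =>
    obtain ⟨C, hCS, hC, hp⟩ := hp
    have hxC : x ∉ C := fun h => hxS (hCS h)
    have hyC : y ∉ C := fun h => hyS (hCS h)
    by_cases h4 : 4 ≤ (M ∩ C).card
    · obtain ⟨u, v, p, hpp, rfl⟩ := hC.exists_path
      have h2 := cyclePacking_two_of_path hxy hpp (by simpa using hxC) (by simpa using hyC)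
        (M := M ∩ p.support.toFinset) Finset.inter_subset_right
        (fun a ha => hMx a (Finset.mem_inter.1 ha).1)
        (fun a ha => hMy a (Finset.mem_inter.1 ha).1) h4
      obtain ⟨A, hA, hAc, B, hB, hBc, -⟩ := h2
      refine ⟨A, hA.trans ?_, hAc, B, hB.trans ?_, hBc, hp.mono ?_⟩
      · exact Finset.insert_subset_insert _ (Finset.insert_subset_insert _ hCS)
      · exact Finset.sdiff_subset_sdiff (Finset.insert_subset_insert _
          (Finset.insert_subset_insert _ hCS)) subset_rfl
      · intro z hz
        have hzA : z ∉ A := fun h => by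
          have := hA h
          simp only [Finset.mem_insert, Finset.mem_sdiff] at this hz
          rcases this with rfl | rfl | h
          · exact hxS hz.1
          · exact hyS hz.1
          · exact hz.2 h
        have hzB : z ∉ B := fun h => by
          have := (Finset.mem_sdiff.1 (hB h)).1
          simp only [Finset.mem_insert, Finset.mem_sdiff] at this hz
          rcases this with rfl | rfl | h
          · exact hxS hz.1
          · exact hyS hz.1
          · exact hz.2 h
        simp only [Finset.mem_sdiff, Finset.mem_insert] at hz ⊢
        exact ⟨⟨Or.inr (Or.inr hz.1), hzA⟩, hzB⟩
    · have hsum := Finset.card_inter_add_card_sdiff M C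
      have := ih (M := M \ C) hp (by simp [hxS]) (by simp [hyS])
        (Finset.sdiff_subset_sdiff hMS subset_rfl)
        (fun a ha => hMx a (Finset.mem_sdiff.1 ha).1)
        (fun a ha => hMy a (Finset.mem_sdiff.1 ha).1) (by omega)
      refine ⟨C, hCS.trans (by intro z hz; simp [hz]), hC, this.mono ?_⟩
      intro z
      simp only [Finset.mem_insert, Finset.mem_sdiff]
      rintro (rfl | rfl | h) <;> simp [*]

/-- Disjoint triangles, each through two vertices of a dominating set and one further vertex. -/
theorem cyclePacking_of_dominating {k : ℕ} {D R : Finset V} (hD : D.card = 2 * k)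
    (hR : k ≤ R.card) (hDR : Disjoint D R)
    (hdom : ∀ d ∈ D, ∀ v ∈ D ∪ R, v ≠ d → G.Adj d v) : G.CyclePacking k (D ∪ R) := by
  induction k generalizing D R with
  | zero => trivial
  | succ k ih =>
    obtain ⟨a, ha, b, hb, hab⟩ := Finset.one_lt_card.1 (show 1 < D.card by omega)
    obtain ⟨r, hr⟩ := Finset.card_pos.1 (show 0 < R.card by omega)
    have hraD : ∀ d ∈ D, r ≠ d := fun d hd h => Finset.disjoint_left.1 hDR hd (h ▸ hr)
    have htri := containsCycle_triangle (hdom a ha b (by simp [hb]) hab.symm)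
      (hdom a ha r (by simp [hr]) (hraD a ha)) (hdom b hb r (by simp [hr]) (hraD b hb))
    have hba : b ∈ D.erase a := Finset.mem_erase.2 ⟨hab.symm, hb⟩
    have hrest := ih (D := (D.erase a).erase b) (R := R.erase r)
      (by rw [Finset.card_erase_of_mem hba, Finset.card_erase_of_mem ha]; omega)
      (by rw [Finset.card_erase_of_mem hr]; omega)
      (hDR.mono ((Finset.erase_subset _ _).trans (Finset.erase_subset _ _))
        (Finset.erase_subset _ _))
      (by
        intro d hd v hv
        refine hdom d (by simp at hd; exact hd.2.2) v ?_
        simp at hv ⊢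
        tauto)
    refine (hrest.succ_of_containsCycle htri ?_).mono ?_
    · rw [Finset.disjoint_left]
      intro z
      have := Finset.disjoint_left.1 hDR
      simp only [Finset.mem_insert, Finset.mem_singleton, Finset.mem_union, Finset.mem_erase]
      rintro (rfl | rfl | rfl) <;> tauto
    · intro z
      simp only [Finset.mem_insert, Finset.mem_singleton, Finset.mem_union, Finset.mem_erase]
      rintro ((rfl | rfl | rfl) | h) <;> tauto

variable [DecidableRel G.Adj]

theorem degIn_union {A B : Finset V} (h : Disjoint A B) (v : V) :
    G.degIn (A ∪ B) v = G.degIn A v + G.degIn B v := by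
  rw [degIn, Finset.filter_union, Finset.card_union_of_disjoint]
  · rfl
  · exact Finset.disjoint_filter_filter h

theorem adj_of_degIn_add_one_eq_card {S : Finset V} {v u : V} (hv : v ∈ S)
    (h : S.card ≤ G.degIn S v + 1) (hu : u ∈ S) (huv : u ≠ v) : G.Adj v u := by
  by_contra hadj
  have : S.filter (G.Adj v) ⊆ (S.erase v).erase u := by
    intro z hz
    rw [Finset.mem_filter] at hz
    refine Finset.mem_erase.2 ⟨fun h => hadj (h ▸ hz.2), Finset.mem_erase.2 ⟨hz.2.ne', hz.1⟩⟩
  have hle := Finset.card_le_card this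
  rw [Finset.card_erase_of_mem (Finset.mem_erase.2 ⟨huv, hu⟩), Finset.card_erase_of_mem hv] at hle
  have : 1 < S.card := Finset.one_lt_card.2 ⟨u, hu, v, hv, huv⟩
  rw [degIn] at h
  omega

theorem degSum_union {A B : Finset V} (h : Disjoint A B) :
    G.degSum (A ∪ B) = G.degSum A + G.degSum B + 2 * ∑ v ∈ A, G.degIn B v := by
  rw [degSum, Finset.sum_union h]
  simp only [degIn_union h, Finset.sum_add_distrib]
  rw [sum_degIn_comm B A, degSum, degSum]
  ring

theorem degSum_eq_sdiff {S C : Finset V} (h : C ⊆ S) :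
    G.degSum S = G.degSum (S \ C) + G.degSum C + 2 * ∑ v ∈ S \ C, G.degIn C v := by
  rw [← degSum_union Finset.sdiff_disjoint, Finset.sdiff_union_of_subset h]

theorem degSum_le_sdiff {S C : Finset V} (h : C ⊆ S) :
    G.degSum S ≤ G.degSum (S \ C) + 2 * ∑ v ∈ C, G.degIn S v := by
  have h1 : ∑ v ∈ C, G.degIn S v = ∑ v ∈ C, G.degIn (S \ C) v + G.degSum C := by
    rw [degSum, ← Finset.sum_add_distrib]
    refine Finset.sum_congr rfl fun v _ => ?_
    rw [← degIn_union Finset.sdiff_disjoint, Finset.sdiff_union_of_subset h]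
  rw [degSum_eq_sdiff h, h1, sum_degIn_comm]
  omega

theorem degSum_erase {S : Finset V} {v : V} (hv : v ∈ S) :
    G.degSum S = G.degSum (S.erase v) + 2 * G.degIn S v := by
  have h0 : G.degIn {v} v = 0 := by simp [degIn, Finset.filter_singleton]
  have h1 : G.degIn S v = G.degIn (S.erase v) v := by
    conv_lhs => rw [← Finset.insert_erase hv]
    rw [degIn, Finset.filter_insert, if_neg (G.loopless.irrefl v), degIn]
  have h2 : G.degSum {v} = 0 := by rw [degSum, Finset.sum_singleton, h0]
  have := degSum_eq_sdiff (G := G) (Finset.singleton_subset_iff.2 hv)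
  rw [sum_degIn_comm, Finset.sum_singleton, Finset.sdiff_singleton_eq_erase, ← h1] at this
  omega

theorem containsCycle_of_two_le_degIn {S : Finset V} (hS : S.Nonempty)
    (h : ∀ v ∈ S, 2 ≤ G.degIn S v) : G.ContainsCycle S := by
  by_contra hcyc
  have long : ∀ n : ℕ, ∃ (u v : V) (p : G.Walk u v), p.IsPath ∧ (∀ z ∈ p.support, z ∈ S) ∧
      p.length = n := by
    intro n
    induction n with
    | zero =>
      obtain ⟨v, hv⟩ := hS
      exact ⟨v, v, Walk.nil, by simp, by simpa using hv, rfl⟩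
    | succ n ih =>
      obtain ⟨u, v, p, hp, hpS, hn⟩ := ih
      obtain ⟨a, ha, b, hb, hab, hua, hub⟩ :=
        exists_ne_of_two_le_degIn (h u (hpS u p.start_mem_support))
      by_contra hno
      have hsupp : ∀ c ∈ S, G.Adj u c → c ∈ p.support := by
        intro c hc huc
        by_contra hcp
        exact hno ⟨c, v, Walk.cons huc.symm p, by simp [Walk.cons_isPath_iff, hp, hcp],
          by simpa [hc] using hpS, by simp [hn]⟩
      have hap := hsupp a ha hua
      have hbp := hsupp b hb hub
      cases p with
      | nil => simp at hap; exact hua.ne' hap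
      | cons huw q =>
        rw [Walk.cons_isPath_iff] at hp
        rw [Walk.support_cons, List.mem_cons] at hap hbp
        have haq := hap.resolve_left hua.ne'
        have hbq := hbp.resolve_left hub.ne'
        have hsub : ∀ r : G.Walk a b, (∀ z ∈ r.support, z ∈ q.support) → False := by
          intro r hr
          refine hcyc ((containsCycle_of_walk r (fun hu => hp.2 (hr u hu)) hua hub hab).mono ?_)
          rw [Finset.insert_subset_iff]
          exact ⟨hpS u (by simp), fun z hz => hpS z
            (by simp [hr z (List.mem_toFinset.1 hz)])⟩
        refine hsub ((q.takeUntil a haq).reverse.append (q.takeUntil b hbq)) fun z hz => ?_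
        rw [Walk.mem_support_append_iff, Walk.support_reverse, List.mem_reverse] at hz
        rcases hz with hz | hz
        · exact q.support_takeUntil_subset_support _ hz
        · exact q.support_takeUntil_subset_support _ hz
  obtain ⟨u, v, p, hp, hpS, hn⟩ := long S.card
  have hle : p.support.toFinset.card ≤ S.card :=
    Finset.card_le_card fun z hz => hpS z (List.mem_toFinset.1 hz)
  rw [List.toFinset_card_of_nodup hp.support_nodup, Walk.length_support] at hle
  omega

theorem containsCycle_of_two_mul_card_le_degSum {S : Finset V} (hS : S.Nonempty)
    (h : 2 * S.card ≤ G.degSum S) : G.ContainsCycle S := by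
  induction S using Finset.strongInduction with
  | H S ih =>
    by_cases hdeg : ∀ v ∈ S, 2 ≤ G.degIn S v
    · exact containsCycle_of_two_le_degIn hS hdeg
    · push Not at hdeg
      obtain ⟨v, hv, hlt⟩ := hdeg
      have hsum := degSum_erase (G := G) hv
      have hcard := Finset.card_erase_of_mem hv
      have hpos := hS.card_pos
      rcases (S.erase v).eq_empty_or_nonempty with he | hne
      · rw [he] at hsum hcard
        simp only [degSum, Finset.sum_empty, Finset.card_empty] at hsum hcard
        have := degIn_lt_card (G := G) hv
        rw [degSum] at h
        omega
      · exact (ih _ (Finset.erase_ssubset hv) hne (by omega)).mono (Finset.erase_subset _ _)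

/-- A Bonferroni inequality for sets with small pairwise intersections. -/
theorem sum_card_le_card_add_choose {ι : Type*} [DecidableEq ι] {C : Finset ι}
    {A : ι → Finset V} {S : Finset V} {m : ℕ} (hA : ∀ i ∈ C, A i ⊆ S)
    (h : ∀ i ∈ C, ∀ j ∈ C, i ≠ j → (A i ∩ A j).card ≤ m) :
    ∑ i ∈ C, (A i).card ≤ S.card + C.card.choose 2 * m := by
  suffices ∑ i ∈ C, (A i).card ≤ (C.biUnion A).card + C.card.choose 2 * m from
    this.trans (Nat.add_le_add_right (Finset.card_le_card (Finset.biUnion_subset.2 hA)) _)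
  clear hA
  induction C using Finset.induction_on with
  | empty => simp
  | insert i C hi ih =>
    have ih := ih fun a ha b hb => h a (Finset.mem_insert_of_mem ha) b (Finset.mem_insert_of_mem hb)
    have h0 : (C.card + 1).choose 2 = C.card + C.card.choose 2 := by
      rw [Nat.choose_succ_succ' C.card 1, Nat.choose_one_right]
    rw [Finset.sum_insert hi, Finset.biUnion_insert, Finset.card_insert_of_notMem hi, h0]
    have h1 := Finset.card_union_add_card_inter (A i) (C.biUnion A)
    have h2 : (A i ∩ C.biUnion A).card ≤ C.card * m := by
      rw [Finset.inter_biUnion]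
      refine Finset.card_biUnion_le.trans ?_
      refine (Finset.sum_le_card_nsmul C _ m fun j hj => ?_).trans_eq (smul_eq_mul _ _)
      exact h i (Finset.mem_insert_self _ _) j (Finset.mem_insert_of_mem hj)
        (fun hij => hi (hij ▸ hj))
    rw [Nat.add_mul]
    omega

/-- If any two vertices have at most one common neighbor, then the degree sum is small. -/
theorem degSum_sq_le {T : Finset V}
    (h : ∀ a ∈ T, ∀ b ∈ T, a ≠ b → (T.filter fun z => G.Adj a z ∧ G.Adj b z).card ≤ 1) :
    G.degSum T ^ 2 ≤ T.card * (T.card * T.card + G.degSum T) := by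
  have hcount : ∑ v ∈ T, G.degIn T v ^ 2 =
      ∑ a ∈ T, ∑ b ∈ T, (T.filter fun z => G.Adj a z ∧ G.Adj b z).card := by
    have : ∀ v, G.degIn T v ^ 2 =
        ∑ a ∈ T, ∑ b ∈ T, if G.Adj a v ∧ G.Adj b v then 1 else 0 := by
      intro v
      rw [sq, degIn, Finset.card_filter, Finset.sum_mul_sum]
      refine Finset.sum_congr rfl fun a _ => Finset.sum_congr rfl fun b _ => ?_
      simp only [G.adj_comm v, ite_and, ite_mul, one_mul, zero_mul]
    simp only [this, Finset.card_filter]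
    rw [Finset.sum_comm]
    exact Finset.sum_congr rfl fun a _ => Finset.sum_comm
  refine (sq_sum_le_card_mul_sum_sq (s := T) (f := G.degIn T)).trans ?_
  refine Nat.mul_le_mul_left _ ?_
  rw [hcount]
  have hrow : ∀ a ∈ T, ∑ b ∈ T, (T.filter fun z => G.Adj a z ∧ G.Adj b z).card ≤
      T.card + G.degIn T a := by
    intro a ha
    rw [← Finset.sum_erase_add _ _ ha]
    refine Nat.add_le_add ?_ (by simp [degIn])
    refine (Finset.sum_le_card_nsmul _ _ 1 fun b hb => ?_).trans ?_
    · rw [Finset.mem_erase] at hb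
      exact h a ha b hb.2 hb.1.symm
    · simpa using Finset.card_erase_le
  refine (Finset.sum_le_sum hrow).trans_eq ?_
  rw [Finset.sum_add_distrib, Finset.sum_const, smul_eq_mul, degSum]

theorem degIn_le_one_of_minimal_cycle {S C : Finset V} (hC : G.IsCycleSet C) (hCS : C ⊆ S)
    (hmin : ∀ C' ⊆ S, G.IsCycleSet C' → C.card ≤ C'.card) (h5 : 5 ≤ C.card) {x : V}
    (hx : x ∈ S) (hxC : x ∉ C) : G.degIn C x ≤ 1 := by
  by_contra! h
  obtain ⟨a, ha, b, hb, hab, hxa, hxb⟩ := exists_ne_of_two_le_degIn h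
  obtain ⟨u, w, hw, rfl⟩ := hC
  have hlen := hw.length_le_card_support
  rw [List.mem_toFinset] at ha hb hxC
  have short : ∀ q : G.Walk a b, (∀ z ∈ q.support, z ∈ w.support) →
      w.support.toFinset.card ≤ q.length + 2 := by
    intro q hq
    obtain ⟨C', hC', hsub, hcard⟩ :=
      exists_isCycleSet_of_walk q (fun h => hxC (hq x h)) hxa hxb hab
    refine (hmin C' (hsub.trans ?_) hC').trans hcard
    rw [Finset.insert_subset_iff]
    exact ⟨hx, fun z hz => hCS (List.mem_toFinset.2 (hq z (List.mem_toFinset.1 hz)))⟩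
  have hrot : ∀ z, z ∈ (w.rotate a ha).support ↔ z ∈ w.support := by
    intro z; exact Walk.mem_support_rotate_iff ..
  have hb' := (hrot b).2 hb
  have h1 := short ((w.rotate a ha).takeUntil b hb') fun z hz =>
    (hrot z).1 (Walk.support_takeUntil_subset_support _ _ hz)
  have h2 := short ((w.rotate a ha).dropUntil b hb').reverse fun z hz => by
    rw [Walk.support_reverse, List.mem_reverse] at hz
    exact (hrot z).1 (Walk.support_dropUntil_subset_support _ _ hz)
  have hsum := congrArg Walk.length ((w.rotate a ha).take_spec hb')
  rw [Walk.length_append, Walk.length_rotate] at hsum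
  rw [Walk.length_reverse] at h2
  omega

theorem degSum_le_of_minimal_cycle {S C : Finset V} (hC : G.IsCycleSet C) (hCS : C ⊆ S)
    (hmin : ∀ C' ⊆ S, G.IsCycleSet C' → C.card ≤ C'.card) (h5 : 5 ≤ C.card) :
    G.degSum S ≤ G.degSum (S \ C) + 2 * (S.card + C.card) := by
  have hout : ∑ v ∈ S \ C, G.degIn C v ≤ (S \ C).card := by
    refine (Finset.sum_le_card_nsmul _ _ 1 fun v hv => ?_).trans_eq (by simp)
    rw [Finset.mem_sdiff] at hv
    exact degIn_le_one_of_minimal_cycle hC hCS hmin h5 hv.1 hv.2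
  obtain ⟨v, hv⟩ := Finset.card_pos.1 (show 0 < C.card by omega)
  have hin := degSum_erase (G := G) hv
  have hdeg := degIn_lt_card (G := G) hv
  have hcard := Finset.card_erase_of_mem hv
  have hforest : G.degSum (C.erase v) ≤ 2 * (C.erase v).card := by
    by_contra! hlt
    obtain ⟨C', hC', hc⟩ := containsCycle_of_two_mul_card_le_degSum
      (Finset.card_pos.1 (show 0 < (C.erase v).card by omega)) hlt.le
    have := hmin C' (hC'.trans ((Finset.erase_subset _ _).trans hCS)) hc
    have := Finset.card_le_card hC'
    omega
  have hs := Finset.card_sdiff_add_card_eq_card hCS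
  rw [degSum_eq_sdiff hCS]
  omega

/-- The numerical contradiction for a dense graph on few vertices without short cycles. -/
theorem girth_five_arith {n c N E j D : ℤ} (hj : 2 ≤ j) (hn : 24 * (j + 1) ≤ n)
    (hN0 : 0 ≤ N) (hN : N < 24 * j) (hNc : N = n - c)
    (hD : 2 * (2 * j + 1) * (n - j - 1) ≤ D) (hle : D ≤ E + 2 * (n + c))
    (hsq : E ^ 2 ≤ N * (N * N + E)) : False := by
  have hF : (j + 1) * (92 * j - 50) + 2 * N ≤ E := by
    nlinarith [mul_nonneg (show 0 ≤ 2 * j - 1 by linarith) (sub_nonneg.2 hn)]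
  have hN3 : N ^ 3 ≤ (24 * j) ^ 3 := pow_le_pow_left₀ hN0 hN.le 3
  have hF0 : 0 < (j + 1) * (92 * j - 50) := mul_pos (by linarith) (by linarith)
  have hFsq : (24 * j) ^ 3 < ((j + 1) * (92 * j - 50)) ^ 2 := by
    obtain ⟨m, rfl⟩ : ∃ m : ℤ, j = m + 2 := ⟨j - 2, by ring⟩
    have hm : 0 ≤ m := by linarith
    refine sub_pos.1 ?_
    ring_nf
    positivity
  nlinarith [mul_nonneg hN0 hF0.le, mul_nonneg hN0 (sub_nonneg.2 hF), mul_self_nonneg N,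
    mul_nonneg hF0.le (sub_nonneg.2 hF),
    mul_nonneg (sub_nonneg.2 hF) (sub_nonneg.2 hF)]

/-- If all codegrees are small, then some cycle meets few edges. -/
theorem exists_isCycleSet_degSum_sdiff {S : Finset V} {j : ℕ} (hj : 1 ≤ j)
    (hcard : 24 * (j + 1) ≤ S.card)
    (hdeg : 2 * (2 * (j : ℤ) + 1) * ((S.card : ℤ) - j - 1) ≤ (G.degSum S : ℤ))
    (hpair : ∀ a ∈ S, ∀ b ∈ S, a ≠ b →
      (S.filter fun z => G.Adj a z ∧ G.Adj b z).card ≤ 3 * j + 1) :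
    ∃ C ⊆ S, G.IsCycleSet C ∧ (S \ C).Nonempty ∧ (2 ≤ j → 24 * j ≤ (S \ C).card) ∧
      2 * (2 * (j : ℤ) - 1) * (((S \ C).card : ℤ) - j) + 2 ≤ (G.degSum (S \ C) : ℤ) := by
  have hSne : S.Nonempty := Finset.card_pos.1 (by omega)
  have hjz : (1 : ℤ) ≤ j := by exact_mod_cast hj
  have hcz : 24 * ((j : ℤ) + 1) ≤ (S.card : ℤ) := by exact_mod_cast hcard
  have hcyc : G.ContainsCycle S := by
    refine containsCycle_of_two_mul_card_le_degSum hSne ?_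
    zify
    nlinarith
  obtain ⟨C, hC, hmin⟩ : ∃ C, (C ⊆ S ∧ G.IsCycleSet C) ∧
      ∀ C', (C' ⊆ S ∧ G.IsCycleSet C') → C.card ≤ C'.card := by
    obtain ⟨C₀, hC₀⟩ := hcyc
    obtain ⟨C, hC, hm⟩ := exists_minimalFor_of_wellFoundedLT
      (fun C => C ⊆ S ∧ G.IsCycleSet C) Finset.card ⟨C₀, hC₀⟩
    exact ⟨C, hC, fun C' hC' => (le_total C.card C'.card).elim id (hm hC')⟩
  obtain ⟨hCS, hC⟩ := hC
  refine ⟨C, hCS, hC, ?_⟩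
  have h3 := hC.three_le_card
  have hs := Finset.card_sdiff_add_card_eq_card hCS
  have hsz : ((S \ C).card : ℤ) = S.card - C.card := by rw [← hs]; push_cast; ring
  have h3z : (3 : ℤ) ≤ C.card := by exact_mod_cast h3
  rcases Nat.lt_or_ge C.card 5 with h5 | h5
  · refine ⟨Finset.card_pos.1 (by omega), fun _ => by omega, ?_⟩
    have hsum : ∑ v ∈ C, G.degIn S v ≤ S.card + C.card.choose 2 * (3 * j + 1) := by
      refine sum_card_le_card_add_choose (fun v _ => Finset.filter_subset _ _) ?_
      intro a ha b hb hab
      rw [← Finset.filter_and]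
      exact hpair a (hCS ha) b (hCS hb) hab
    have hchoose : C.card.choose 2 ≤ 6 := Nat.choose_le_choose 2 (show C.card ≤ 4 by omega)
    have hle := degSum_le_sdiff (G := G) hCS
    have hsum' : ∑ v ∈ C, G.degIn S v ≤ S.card + 6 * (3 * j + 1) :=
      hsum.trans (Nat.add_le_add_left (Nat.mul_le_mul_right _ hchoose) _)
    zify at hle hsum'
    rw [hsz]
    nlinarith [mul_nonneg (show (0 : ℤ) ≤ 2 * j - 1 by linarith) (sub_nonneg.2 h3z)]
  · have hle := degSum_le_of_minimal_cycle hC hCS (fun C' h h' => hmin C' ⟨h, h'⟩) h5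
    have h5z : (5 : ℤ) ≤ C.card := by exact_mod_cast h5
    have hcS : (C.card : ℤ) ≤ S.card := by exact_mod_cast Finset.card_le_card hCS
    zify at hle
    refine ⟨?_, fun hj2 => ?_, ?_⟩
    · rw [Finset.nonempty_iff_ne_empty]
      intro h
      have h0 : G.degSum (S \ C) = 0 := by rw [h]; rfl
      rw [h0] at hle
      push_cast at hle
      nlinarith
    · by_contra! hlt
      have hsq := degSum_sq_le (G := G) (T := S \ C) fun a ha b hb hab => by
        by_contra! h
        obtain ⟨p, hp, q, hq, hpq⟩ := Finset.one_lt_card.1 h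
        rw [Finset.mem_filter] at hp hq
        obtain ⟨C', hC', hc⟩ :=
          containsCycle_square hab hpq hp.2.1 hq.2.1 hp.2.2 hq.2.2
        have h4 := (Finset.card_le_card hC').trans Finset.card_le_four
        have := hmin C' ⟨hC'.trans ?_, hc⟩
        · omega
        · intro z hz
          simp only [Finset.mem_insert, Finset.mem_singleton] at hz
          rcases hz with rfl | rfl | rfl | rfl
          · exact (Finset.mem_sdiff.1 ha).1
          · exact (Finset.mem_sdiff.1 hb).1
          · exact (Finset.mem_sdiff.1 hp.1).1
          · exact (Finset.mem_sdiff.1 hq.1).1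
      zify at hsq hlt hj2
      exact girth_five_arith hj2 hcz (Int.natCast_nonneg _) hlt hsz hdeg hle hsq
    · rw [hsz]
      nlinarith [mul_nonneg (show (0 : ℤ) ≤ 2 * j - 2 by linarith) (sub_nonneg.2 h5z)]

/-- A dense forest is a star or has two disjoint edges. -/
theorem containsCycle_or_star_or_disjoint_edges {S : Finset V} (hS : S.Nonempty)
    (hdeg : 2 * S.card ≤ G.degSum S + 2) :
    G.ContainsCycle S ∨ (∃ a ∈ S, ∀ v ∈ S, v ≠ a → G.Adj a v) ∨
      ∃ p ∈ S, ∃ q ∈ S, ∃ r ∈ S, ∃ s ∈ S, G.Adj p q ∧ G.Adj r s ∧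
        Disjoint ({p, q} : Finset V) {r, s} := by
  by_cases hcyc : G.ContainsCycle S
  · exact Or.inl hcyc
  refine Or.inr ?_
  by_contra! hno
  obtain ⟨hstar, hdisj⟩ := hno
  have hmeet : ∀ p ∈ S, ∀ q ∈ S, ∀ r ∈ S, ∀ s ∈ S, G.Adj p q → G.Adj r s →
      p = r ∨ p = s ∨ q = r ∨ q = s := by
    intro p hp q hq r hr s hs hpq hrs
    by_contra! h
    refine hdisj p hp q hq r hr s hs hpq hrs ?_
    simp [h.1.symm, h.2.1.symm, h.2.2.1.symm, h.2.2.2.symm]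
  have htri : ∀ p ∈ S, ∀ q ∈ S, ∀ r ∈ S, G.Adj p q → G.Adj p r → ¬ G.Adj q r := by
    intro p hp q hq r hr hpq hpr hqr
    refine hcyc ((containsCycle_triangle hpq hpr hqr).mono ?_)
    intro z
    simp only [Finset.mem_insert, Finset.mem_singleton]
    rintro (rfl | rfl | rfl) <;> assumption
  have hcover : ∃ a ∈ S, ∀ r ∈ S, ∀ s ∈ S, G.Adj r s → a = r ∨ a = s := by
    by_cases hedge : ∃ a ∈ S, ∃ b ∈ S, G.Adj a b
    · obtain ⟨a, ha, b, hb, hab⟩ := hedge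
      by_contra! hcov
      obtain ⟨r, hr, s, hs, hrs, har, has⟩ := hcov a ha
      obtain ⟨t, ht, u, hu, htu, hbt, hbu⟩ := hcov b hb
      have h1 : b = r ∨ b = s := by simpa [har, has] using hmeet a ha b hb r hr s hs hab hrs
      have h2 : a = t ∨ a = u := by simpa [hbt, hbu] using hmeet a ha b hb t ht u hu hab htu
      have h3 := hmeet r hr s hs t ht u hu hrs htu
      have h4 : ∀ c ∈ S, G.Adj a c → ¬ G.Adj b c := fun c hc => htri a ha b hb c hc hab
      have hrs' := hrs.symm
      have htu' := htu.symm
      clear hmeet htri hstar hdisj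
      rcases h1 with rfl | rfl <;> rcases h2 with rfl | rfl <;>
        rcases h3 with rfl | rfl | rfl | rfl <;>
        first
        | exact har rfl
        | exact has rfl
        | exact hbt rfl
        | exact hbu rfl
        | exact h4 _ hr (by assumption) (by assumption)
        | exact h4 _ hs (by assumption) (by assumption)
    · push Not at hedge
      obtain ⟨a, ha⟩ := hS
      exact ⟨a, ha, fun r hr s hs hrs => absurd hrs (hedge r hr s hs)⟩
  obtain ⟨a, ha, hcov⟩ := hcover
  have hzero : G.degSum (S.erase a) = 0 := by
    refine Finset.sum_eq_zero fun r hr => Finset.card_eq_zero.2 ?_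
    rw [Finset.mem_erase] at hr
    refine Finset.filter_eq_empty_iff.2 fun s hs hrs => ?_
    rw [Finset.mem_erase] at hs
    exact (hcov r hr.2 s hs.2 hrs).elim (fun h => hr.1 h.symm) fun h => hs.1 h.symm
  have hsum := degSum_erase (G := G) ha
  obtain ⟨v, hv, hva, hadj⟩ := hstar a ha
  exact hadj (adj_of_degIn_add_one_eq_card ha (by omega) hv hva)

/-- Two vertices of large codegree, outside of which there is a dominating set. -/
theorem cyclePacking_or_dominating {S D : Finset V} {x y : V} {j : ℕ} (hj : 1 ≤ j)
    (hx : x ∈ S) (hy : y ∈ S) (hxy : x ≠ y) (hcard : 24 * (j + 1) ≤ S.card)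
    (hdeg : 2 * (2 * (j : ℤ) + 1) * ((S.card : ℤ) - j - 1) ≤ (G.degSum S : ℤ))
    (hcommon : 3 * j + 2 ≤ (S.filter fun z => G.Adj x z ∧ G.Adj y z).card)
    (hDS : D ⊆ (S.erase x).erase y) (hDcard : D.card = 2 * j - 1)
    (hdom : ∀ d ∈ D, ∀ v ∈ (S.erase x).erase y, v ≠ d → G.Adj d v) :
    G.CyclePacking (j + 1) S ∨
      ∃ D ⊆ S, D.card = 2 * j + 1 ∧ ∀ d ∈ D, ∀ v ∈ S, v ≠ d → G.Adj d v := by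
  have hxD : x ∉ D := fun h => by simpa using hDS h
  have hyD : y ∉ D := fun h => by simpa using hDS h
  set A := insert x (insert y D) with hA
  have hAS : A ⊆ S := Finset.insert_subset hx (Finset.insert_subset hy
    (hDS.trans ((Finset.erase_subset _ _).trans (Finset.erase_subset _ _))))
  have hAcard : A.card = 2 * j + 1 := by
    rw [hA, Finset.card_insert_of_notMem (by simp [hxy, hxD]), Finset.card_insert_of_notMem hyD]
    omega
  have hRcard := Finset.card_sdiff_add_card_eq_card hAS
  by_cases hedge : ∃ p ∈ S \ A, ∃ q ∈ S \ A, G.Adj p q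
  · left
    obtain ⟨p, hp, q, hq, hpq⟩ := hedge
    obtain ⟨d, hd⟩ := Finset.card_pos.1 (show 0 < D.card by omega)
    simp only [hA, Finset.mem_sdiff, Finset.mem_insert, not_or] at hp hq
    set M := (S.filter fun z => G.Adj x z ∧ G.Adj y z) \ insert p (insert q D) with hM
    have hMcard : 1 < M.card := by
      have h1 := Finset.le_card_sdiff (insert p (insert q D))
        (S.filter fun z => G.Adj x z ∧ G.Adj y z)
      rw [← hM] at h1
      have h2 := Finset.card_insert_le p (insert q D)
      have h3 := Finset.card_insert_le q D
      omega
    obtain ⟨a, ha, b, hb, hab⟩ := Finset.one_lt_card.1 hMcard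
    simp only [hM, Finset.mem_sdiff, Finset.mem_filter, Finset.mem_insert, not_or] at ha hb
    have hsq := containsCycle_square hxy hab ha.1.2.1 hb.1.2.1 ha.1.2.2 hb.1.2.2
    have hdp := hdom d hd p (by simp [hp]) (fun h => hp.2.2.2 (h ▸ hd))
    have hdq := hdom d hd q (by simp [hq]) (fun h => hq.2.2.2 (h ▸ hd))
    have htri := containsCycle_triangle hdp hdq hpq
    obtain ⟨i, rfl⟩ : ∃ i, j = i + 1 := ⟨j - 1, by omega⟩
    have hrest := cyclePacking_of_dominating (G := G) (k := i) (D := D.erase d)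
      (R := (S \ A) \ {p, q, a, b}) (by rw [Finset.card_erase_of_mem hd]; omega)
      (by
        have h1 := Finset.le_card_sdiff {p, q, a, b} (S \ A)
        have h2 : ({p, q, a, b} : Finset V).card ≤ 4 := Finset.card_le_four
        omega)
      (by
        rw [Finset.disjoint_left]
        intro z hz hz'
        simp only [hA, Finset.mem_sdiff, Finset.mem_insert, Finset.mem_erase] at hz hz'
        tauto)
      (by
        intro e he v hv
        refine hdom e (Finset.mem_of_mem_erase he) v ?_
        rcases Finset.mem_union.1 hv with hv | hv
        · exact hDS (Finset.mem_of_mem_erase hv)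
        · simp only [hA, Finset.mem_sdiff, Finset.mem_insert, Finset.mem_erase] at hv ⊢
          tauto)
    have hdx : d ≠ x := fun h => hxD (h ▸ hd)
    have hdy : d ≠ y := fun h => hyD (h ▸ hd)
    have hda : d ≠ a := fun h => ha.2.2.2 (h ▸ hd)
    have hdb : d ≠ b := fun h => hb.2.2.2 (h ▸ hd)
    have hdS : d ∈ S := hAS (by simp [hA, hd])
    have hax := ha.1.2.1.ne
    have hay := ha.1.2.2.ne
    have hbx := hb.1.2.1.ne
    have hby := hb.1.2.2.ne
    refine ((hrest.succ_of_containsCycle htri ?_).succ_of_containsCycle hsq ?_).mono ?_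
    · rw [Finset.disjoint_left]
      intro z
      simp only [hA, Finset.mem_insert, Finset.mem_singleton, Finset.mem_union, Finset.mem_erase,
        Finset.mem_sdiff]
      grind
    · rw [Finset.disjoint_left]
      intro z
      simp only [hA, Finset.mem_insert, Finset.mem_singleton, Finset.mem_union, Finset.mem_erase,
        Finset.mem_sdiff]
      grind
    · refine Finset.union_subset ?_ (Finset.union_subset ?_ (Finset.union_subset ?_ ?_))
      · simp [Finset.insert_subset_iff, hx, hy, ha.1.1, hb.1.1]
      · simp [Finset.insert_subset_iff, hdS, hp.1, hq.1]
      · exact (Finset.erase_subset _ _).trans ((Finset.subset_insert _ _).trans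
          ((Finset.subset_insert _ _).trans hAS))
      · exact Finset.sdiff_subset.trans Finset.sdiff_subset
  · right
    push Not at hedge
    refine ⟨A, hAS, hAcard, fun d hd v hv hvd => ?_⟩
    refine adj_of_degIn_add_one_eq_card (hAS hd) ?_ hv hvd
    by_contra! hlt
    have hout : ∑ r ∈ S \ A, G.degIn S r ≤ (S \ A).card * (2 * j + 1) := by
      refine (Finset.sum_le_card_nsmul _ _ (2 * j + 1) fun r hr => ?_).trans_eq (smul_eq_mul _ _)
      rw [← hAcard]
      refine Finset.card_le_card fun z hz => ?_
      rw [Finset.mem_filter] at hz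
      by_contra hzA
      exact hedge r hr z (Finset.mem_sdiff.2 ⟨hz.1, hzA⟩) hz.2
    have hin : ∑ a ∈ A, (G.degIn S a + 1) < A.card * S.card := by
      refine (Finset.sum_lt_sum (g := fun _ => S.card)
        (fun a ha => degIn_lt_card (hAS ha)) ⟨d, hd, hlt⟩).trans_eq (by simp)
    have htot : G.degSum S = ∑ r ∈ S \ A, G.degIn S r + ∑ a ∈ A, G.degIn S a :=
      (Finset.sum_sdiff hAS).symm
    rw [Finset.sum_add_distrib, Finset.sum_const, smul_eq_mul, mul_one] at hin
    zify at hin hout htot hRcard hAcard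
    rw [hAcard] at hin hRcard
    nlinarith

theorem degSum_erase_erase {S : Finset V} {x y : V} (hx : x ∈ S) (hy : y ∈ S) (hxy : x ≠ y) :
    G.degSum S = G.degSum ((S.erase x).erase y) +
      2 * (G.degIn S x + G.degIn (S.erase x) y) := by
  rw [degSum_erase hx, degSum_erase (v := y) (Finset.mem_erase.2 ⟨hxy.symm, hy⟩)]
  ring

/-- The inductive form of the Erdős–Pósa theorem, for induced subgraphs. For `k = 1` a spanning
forest with two disjoint edges is a further possibility. -/
theorem cyclePacking_or_dominating_or_disjoint_edges {k : ℕ} (hk : 1 ≤ k) {S : Finset V}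
    (hcard : 24 * k ≤ S.card)
    (hdeg : 2 * (2 * (k : ℤ) - 1) * ((S.card : ℤ) - k) ≤ (G.degSum S : ℤ)) :
    G.CyclePacking k S ∨
      (∃ D ⊆ S, D.card = 2 * k - 1 ∧ ∀ d ∈ D, ∀ v ∈ S, v ≠ d → G.Adj d v) ∨
      (k = 1 ∧ ∃ p ∈ S, ∃ q ∈ S, ∃ r ∈ S, ∃ s ∈ S, G.Adj p q ∧ G.Adj r s ∧
        Disjoint ({p, q} : Finset V) {r, s}) := by
  induction k, hk using Nat.le_induction generalizing S with
  | base =>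
    have hne : S.Nonempty := Finset.card_pos.1 (by omega)
    rcases containsCycle_or_star_or_disjoint_edges hne (by zify; push_cast at hdeg; linarith) with
      h | ⟨a, ha, h⟩ | h
    · exact Or.inl (containsCycle_iff_cyclePacking_one.1 h)
    · exact Or.inr (Or.inl ⟨{a}, by simpa using ha, by simp, by simpa using h⟩)
    · exact Or.inr (Or.inr ⟨rfl, h⟩)
  | succ j hj ih =>
    have hcz : 24 * ((j : ℤ) + 1) ≤ (S.card : ℤ) := by exact_mod_cast hcard
    have hjz : (1 : ℤ) ≤ j := by exact_mod_cast hj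
    have hd : 2 * (2 * (j : ℤ) + 1) * ((S.card : ℤ) - j - 1) ≤ (G.degSum S : ℤ) := by
      push_cast at hdeg
      linarith
    by_cases hpair : ∀ a ∈ S, ∀ b ∈ S, a ≠ b →
      (S.filter fun z => G.Adj a z ∧ G.Adj b z).card ≤ 3 * j + 1
    · left
      obtain ⟨C, hCS, hC, hne, hsize, hdegC⟩ := exists_isCycleSet_degSum_sdiff hj hcard hd hpair
      refine ⟨C, hCS, hC, ?_⟩
      rcases Nat.lt_or_ge j 2 with hj2 | hj2
      · obtain rfl : j = 1 := by omega
        push_cast at hdegC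
        exact containsCycle_iff_cyclePacking_one.1
          (containsCycle_of_two_mul_card_le_degSum hne (by zify; linarith))
      · rcases ih (hsize hj2) (by linarith) with
          h | ⟨D, hDS, hDcard, hdom⟩ | ⟨h, -⟩
        · exact h
        · exfalso
          obtain ⟨a, ha, b, hb, hab⟩ := Finset.one_lt_card.1 (show 1 < D.card by omega)
          have h1 := hpair a (Finset.mem_sdiff.1 (hDS ha)).1 b (Finset.mem_sdiff.1 (hDS hb)).1 hab
          have h2 : ((S \ C).erase a).erase b ⊆ S.filter fun z => G.Adj a z ∧ G.Adj b z := by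
            intro z hz
            simp only [Finset.mem_erase] at hz
            exact Finset.mem_filter.2 ⟨(Finset.mem_sdiff.1 hz.2.2).1, hdom a ha z hz.2.2 hz.2.1,
              hdom b hb z hz.2.2 hz.1⟩
          have h3 := Finset.card_le_card h2
          have h4 := Finset.pred_card_le_card_erase (s := (S \ C).erase a) (a := b)
          have h5 := Finset.pred_card_le_card_erase (s := S \ C) (a := a)
          have := hsize hj2
          omega
        · omega
    · push Not at hpair
      obtain ⟨x, hx, y, hy, hxy, hcommon⟩ := hpair
      rw [← or_assoc]
      left
      have hyx : y ∈ S.erase x := Finset.mem_erase.2 ⟨hxy.symm, hy⟩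
      set T := (S.erase x).erase y with hT
      have hTcard : T.card + 2 = S.card := by
        rw [hT, Finset.card_erase_of_mem hyx, Finset.card_erase_of_mem hx]; omega
      have hTz : (T.card : ℤ) = S.card - 2 := by rw [← hTcard]; push_cast; ring
      have hST : insert x (insert y T) = S := by
        rw [hT, Finset.insert_erase hyx, Finset.insert_erase hx]
      have hdx := degIn_lt_card (G := G) hx
      have hdy := degIn_lt_card (G := G) hyx
      rw [Finset.card_erase_of_mem hx] at hdy
      have hsum := degSum_erase_erase (G := G) hx hy hxy
      rw [← hT] at hsum
      have hM : ∀ k, G.CyclePacking k T → k ≤ j → G.CyclePacking (k + 1) S := by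
        intro k hk hkj
        rw [← hST]
        refine hk.succ_of_common_neighbors hxy (M := S.filter fun z => G.Adj x z ∧ G.Adj y z)
          (by simp [hT]) (by simp [hT]) (fun z hz => ?_)
          (fun a ha => (Finset.mem_filter.1 ha).2.1) (fun a ha => (Finset.mem_filter.1 ha).2.2)
          (by omega)
        rw [Finset.mem_filter] at hz
        simp only [hT, Finset.mem_erase]
        exact ⟨hz.2.2.ne', hz.2.1.ne', hz.1⟩
      have hTdeg : 2 * (2 * (j : ℤ) - 1) * ((T.card : ℤ) - j) ≤ (G.degSum T : ℤ) := by
        have h1 : G.degIn S x + G.degIn (S.erase x) y + 3 ≤ 2 * S.card := by omega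
        zify at h1 hsum
        rw [hTz]
        nlinarith
      rcases ih (by omega) hTdeg with h | ⟨D, hDT, hDcard, hdom⟩ | ⟨rfl, h⟩
      · exact Or.inl (hM j h le_rfl)
      · rcases cyclePacking_or_dominating hj hx hy hxy hcard hd hcommon hDT hDcard hdom with h | h
        · exact Or.inl h
        · exact Or.inr h
      · left
        by_cases hcyc : G.ContainsCycle T
        · exact hM 1 (containsCycle_iff_cyclePacking_one.1 hcyc) le_rfl
        have hTforest : G.degSum T < 2 * T.card := by
          by_contra! hle
          exact hcyc (containsCycle_of_two_mul_card_le_degSum (Finset.card_pos.1 (by omega)) hle)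
        obtain ⟨p, hp, q, hq, r, hr, s, hs, hpq, hrs, hdisj⟩ := h
        have hd' : 6 * S.card ≤ G.degSum S + 12 := by
          zify
          push_cast at hd
          linarith
        have hdx' : S.card ≤ G.degIn S x + 1 := by omega
        have hdy' : (S.erase x).card ≤ G.degIn (S.erase x) y + 1 := by
          rw [Finset.card_erase_of_mem hx]
          omega
        have hTS : T ⊆ S.erase x := Finset.erase_subset _ _
        have hxadj : ∀ z ∈ T, G.Adj x z := fun z hz =>
          adj_of_degIn_add_one_eq_card hx hdx' (Finset.mem_of_mem_erase (hTS hz))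
            (Finset.ne_of_mem_erase (hTS hz))
        have hyadj : ∀ z ∈ T, G.Adj y z := fun z hz =>
          adj_of_degIn_add_one_eq_card hyx hdy' (hTS hz) (Finset.ne_of_mem_erase hz)
        have htx := containsCycle_triangle (hxadj p hp) (hxadj q hq) hpq
        have hty := containsCycle_triangle (hyadj r hr) (hyadj s hs) hrs
        refine ((containsCycle_iff_cyclePacking_one.1 hty).succ_of_containsCycle htx ?_).mono ?_
        · have hxT : ∀ z ∈ T, x ≠ z := fun z hz => (hxadj z hz).ne
          have hyT : ∀ z ∈ T, y ≠ z := fun z hz => (hyadj z hz).ne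
          rw [Finset.disjoint_insert_left, Finset.disjoint_insert_right]
          simp [hxy, hxT r hr, hxT s hs, hyT p hp, hyT q hq, hdisj]
        · have hTS' := hTS.trans (Finset.erase_subset _ _)
          simp [Finset.insert_subset_iff, hx, hy, hTS' hp, hTS' hq,
            hTS' hr, hTS' hs]

end SimpleGraph

/-- **Erdős–Pósa lemma** (Lemma 2 of the paper): if `d > 1`, `v ≥ 24 d`, and a simple
graph `G` on `v` vertices has at least `(2d-1)·v - 2d² + d` edges, then `G` contains
`d` pairwise vertex-disjoint cycles, or `2d-1` vertices each of degree `v - 1`. -/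
theorem erdos_posa_disjoint_cycles {V : Type*} [Fintype V] [DecidableEq V]
    (G : SimpleGraph V) [DecidableRel G.Adj] (d : ℕ) (hd : 1 < d)
    (hv : 24 * d ≤ Fintype.card V)
    (he : (2 * (d : ℤ) - 1) * (Fintype.card V : ℤ) - 2 * (d : ℤ) ^ 2 + (d : ℤ) ≤
      (G.edgeFinset.card : ℤ)) :
    (∃ (c : Fin d → V) (w : ∀ i : Fin d, G.Walk (c i) (c i)),
      (∀ i, (w i).IsCycle) ∧
      ∀ i j, i ≠ j → ∀ x, x ∈ (w i).support → x ∉ (w j).support) ∨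
    (∃ S : Finset V, S.card = 2 * d - 1 ∧
      ∀ v ∈ S, G.degree v = Fintype.card V - 1) := by
  have hdegree : ∀ v, G.degIn Finset.univ v = G.degree v := fun v => by
    rw [← G.card_neighborFinset_eq_degree, G.neighborFinset_eq_filter]
    rfl
  have hsum : G.degSum Finset.univ = 2 * G.edgeFinset.card := by
    rw [← G.sum_degrees_eq_twice_card_edges]
    exact Finset.sum_congr rfl fun v _ => hdegree v
  rcases SimpleGraph.cyclePacking_or_dominating_or_disjoint_edges (G := G) hd.le (S := Finset.univ)
      (by rwa [Finset.card_univ]) (by rw [hsum, Finset.card_univ]; push_cast; linarith) with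
    h | ⟨D, -, hD, hdom⟩ | ⟨h, -⟩
  · obtain ⟨c, w, hw, -, hdisj⟩ := h.exists_walks
    exact Or.inl ⟨c, w, hw, hdisj⟩
  · refine Or.inr ⟨D, hD, fun v hvD => ?_⟩
    rw [← G.card_neighborFinset_eq_degree, ← Finset.card_univ,
      ← Finset.card_erase_of_mem (Finset.mem_univ v)]
    congr 1
    ext u
    rw [G.mem_neighborFinset, Finset.mem_erase]
    exact ⟨fun h => ⟨h.ne', Finset.mem_univ u⟩, fun h => hdom v hvD u h.2 h.1⟩
  · omega
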